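/- arXiv:2411.12314 — 8 statements merged into one kernel-verified Lean document; each statement's English description precedes it below -/
import Mathlib

section
/- Let K be a positive integer and let S be a K×K real symmetric positive definite matrix. The function C ↦ (1/2)·tr(C·S) − (1/2)·log det C, defined on the set of K×K real symmetric positive definite matrices, attains its global minimum at the unique point C = S⁻¹, and the minimum value equals (1/2)·(log det S + K). -/
open Matrix

/-- The log-determinant of a positive definite matrix is at most its trace minus its size. -/
theorem Matrix.PosDef.log_det_le_trace_sub_card {n : Type*} [Fintype n] [DecidableEq n]
    {M : Matrix n n ℝ} (hM : M.PosDef) : Real.log M.det ≤ M.trace - Fintype.card n := by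
  have hdet := hM.1.det_eq_prod_eigenvalues
  have htr := hM.1.trace_eq_sum_eigenvalues
  simp only [RCLike.ofReal_real_eq_id, id_eq] at hdet htr
  rw [hdet, htr, Real.log_prod fun i _ => (hM.eigenvalues_pos i).ne']
  calc ∑ i, Real.log (hM.1.eigenvalues i) ≤ ∑ i, (hM.1.eigenvalues i - 1) :=
        Finset.sum_le_sum fun i _ => Real.log_le_sub_one_of_pos (hM.eigenvalues_pos i)
    _ = _ := by simp

/-- Equality in `Matrix.PosDef.log_det_le_trace_sub_card` forces the identity matrix. -/
theorem Matrix.PosDef.eq_one_of_log_det_eq {n : Type*} [Fintype n] [DecidableEq n]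
    {M : Matrix n n ℝ} (hM : M.PosDef) (h : Real.log M.det = M.trace - Fintype.card n) :
    M = 1 := by
  have hdet := hM.1.det_eq_prod_eigenvalues
  have htr := hM.1.trace_eq_sum_eigenvalues
  simp only [RCLike.ofReal_real_eq_id, id_eq] at hdet htr
  rw [hdet, htr, Real.log_prod fun i _ => (hM.eigenvalues_pos i).ne'] at h
  have hsum : ∑ i, Real.log (hM.1.eigenvalues i) = ∑ i, (hM.1.eigenvalues i - 1) := by
    simpa using h
  have heig : hM.1.eigenvalues = fun _ => 1 := by
    funext i
    by_contra hne
    have heq := (Finset.sum_eq_sum_iff_of_le fun j _ =>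
      Real.log_le_sub_one_of_pos (hM.eigenvalues_pos j)).1 hsum i (Finset.mem_univ i)
    exact (Real.log_lt_sub_one_of_pos (hM.eigenvalues_pos i) hne).ne heq
  have hspec := hM.1.spectral_theorem
  have hdiag : diagonal (RCLike.ofReal ∘ hM.1.eigenvalues : n → ℝ) = 1 := by
    rw [heig]
    ext i j
    simp [diagonal_apply, one_apply]
  rw [hdiag, map_one] at hspec
  exact hspec

/-- A positive definite real matrix factors as `Bᵀ * B` with `B` invertible. -/
theorem Matrix.PosDef.exists_isUnit_transpose_mul_self {n : Type*} [Fintype n] [DecidableEq n]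
    {S : Matrix n n ℝ} (hS : S.PosDef) : ∃ B : Matrix n n ℝ, IsUnit B ∧ S = Bᵀ * B := by
  open scoped MatrixOrder in
  obtain ⟨B, hB⟩ := CStarAlgebra.nonneg_iff_eq_star_mul_self.mp hS.posSemidef.nonneg
  rw [star_eq_conjTranspose, conjTranspose_eq_transpose_of_trivial] at hB
  refine ⟨B, ?_, hB⟩
  have hdet := hS.det_pos
  rw [hB, det_mul, det_transpose] at hdet
  exact (isUnit_iff_isUnit_det B).2 (isUnit_iff_ne_zero.2 fun h => by simp [h] at hdet)

/-- For positive definite `C` and `S`, the log-determinants of `C` and `S` sum to at most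
`tr (C * S) - n`, with equality only at `C = S⁻¹`. -/
theorem Matrix.PosDef.log_det_add_log_det_le {n : Type*} [Fintype n] [DecidableEq n]
    {C S : Matrix n n ℝ} (hC : C.PosDef) (hS : S.PosDef) :
    Real.log C.det + Real.log S.det ≤ (C * S).trace - Fintype.card n ∧
      (Real.log C.det + Real.log S.det = (C * S).trace - Fintype.card n → C = S⁻¹) := by
  obtain ⟨B, hB, rfl⟩ := hS.exists_isUnit_transpose_mul_self
  have hM : (B * C * Bᵀ).PosDef := by
    have := (Matrix.IsUnit.posDef_star_right_conjugate_iff hB).2 hC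
    rwa [star_eq_conjTranspose, conjTranspose_eq_transpose_of_trivial] at this
  have htr : (C * (Bᵀ * B)).trace = (B * C * Bᵀ).trace := by
    rw [← Matrix.mul_assoc, trace_mul_comm, Matrix.mul_assoc]
  have hdet : Real.log C.det + Real.log (Bᵀ * B).det = Real.log (B * C * Bᵀ).det := by
    rw [← Real.log_mul hC.det_pos.ne' hS.det_pos.ne']
    congr 1
    simp only [det_mul]
    ring
  rw [htr, hdet]
  refine ⟨hM.log_det_le_trace_sub_card, fun h => ?_⟩
  have hone := hM.eq_one_of_log_det_eq h
  refine (inv_eq_left_inv ?_).symm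
  rw [Matrix.mul_assoc] at hone
  rw [← Matrix.mul_assoc]
  exact mul_eq_one_comm.1 hone

/-- For a K×K real symmetric positive definite matrix `S`, the map
`C ↦ (1/2)·tr(C·S) − (1/2)·log det C` on symmetric positive definite matrices attains
its global minimum at the unique point `C = S⁻¹`, with minimum value
`(1/2)·(log det S + K)`. -/
theorem stmt0 (K : ℕ) (hK : 0 < K) (S : Matrix (Fin K) (Fin K) ℝ) (hS : S.PosDef) :
    (S⁻¹).PosDef ∧
    (∀ C : Matrix (Fin K) (Fin K) ℝ, C.PosDef →
      (1/2) * (S⁻¹ * S).trace - (1/2) * Real.log (S⁻¹).det ≤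
        (1/2) * (C * S).trace - (1/2) * Real.log C.det) ∧
    (∀ C : Matrix (Fin K) (Fin K) ℝ, C.PosDef →
      (1/2) * (C * S).trace - (1/2) * Real.log C.det =
        (1/2) * (S⁻¹ * S).trace - (1/2) * Real.log (S⁻¹).det → C = S⁻¹) ∧
    (1/2) * (S⁻¹ * S).trace - (1/2) * Real.log (S⁻¹).det =
      (1/2) * (Real.log S.det + K) := by
  have hinv : S⁻¹ * S = 1 := nonsing_inv_mul S (isUnit_iff_ne_zero.2 hS.det_pos.ne')
  have hmin : (1/2) * (S⁻¹ * S).trace - (1/2) * Real.log (S⁻¹).det =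
      (1/2) * (Real.log S.det + K) := by
    rw [hinv, trace_one, Fintype.card_fin, det_nonsing_inv, Ring.inverse_eq_inv', Real.log_inv]
    ring
  refine ⟨hS.inv, fun C hC => ?_, fun C hC h => ?_, hmin⟩
  · have hle := (hC.log_det_add_log_det_le hS).1
    rw [Fintype.card_fin] at hle
    rw [hmin]
    linarith
  · refine (hC.log_det_add_log_det_le hS).2 ?_
    rw [hmin] at h
    rw [Fintype.card_fin]
    linarith
end

section
/- Let K, N be positive integers, let R̂ ∈ ℝ^{KN×KN} be symmetric positive definite, and let W = (W^{[k]})_{1≤k≤K} be a collection of N×N real matrices each of which is invertible. Then the minimum of J_IVA-G(W,C) over all N-tuples C of K×K symmetric positive definite matrices equals J̃_IVA-G(W) + KN/2, where J̃_IVA-G(W) = (1/2)·Σ_{n=1}^N log det(W_n R̂ W_nᵀ) − Σ_{k=1}^K log|det W^{[k]}|. -/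
open Matrix

/-- `blockRow W n` is the K×(K·N) block matrix `W_n` whose k-th row carries the n-th row
of `W^{[k]}` in the k-th block of columns (columns are indexed by `Fin K × Fin N`). -/
def blockRow {K N : ℕ} (W : Fin K → Matrix (Fin N) (Fin N) ℝ) (n : Fin N) :
    Matrix (Fin K) (Fin K × Fin N) ℝ :=
  Matrix.of fun k p => if p.1 = k then W k n p.2 else 0

/-- The IVA-G cost
`J(W,C) = (1/2)·Σₙ [tr(Cₙ Wₙ R̂ Wₙᵀ) − log det Cₙ] − Σₖ log|det W^{[k]}|`. -/
noncomputable def JIVAG {K N : ℕ} (R : Matrix (Fin K × Fin N) (Fin K × Fin N) ℝ)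
    (W : Fin K → Matrix (Fin N) (Fin N) ℝ) (C : Fin N → Matrix (Fin K) (Fin K) ℝ) : ℝ :=
  (1/2) * ∑ n, ((C n * blockRow W n * R * (blockRow W n)ᵀ).trace - Real.log (C n).det)
    - ∑ k, Real.log |(W k).det|

/-- The reduced cost
`J̃(W) = (1/2)·Σₙ log det(Wₙ R̂ Wₙᵀ) − Σₖ log|det W^{[k]}|`. -/
noncomputable def JtIVAG {K N : ℕ} (R : Matrix (Fin K × Fin N) (Fin K × Fin N) ℝ)
    (W : Fin K → Matrix (Fin N) (Fin N) ℝ) : ℝ :=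
  (1/2) * ∑ n, Real.log (blockRow W n * R * (blockRow W n)ᵀ).det
    - ∑ k, Real.log |(W k).det|

open scoped MatrixOrder in
/-- For positive definite `A` and `S`, `log det A + log det S + n ≤ tr (A S)`. -/
lemma log_det_add_log_det_add_card_le_trace_mul {m : Type*} [Fintype m] [DecidableEq m]
    {A S : Matrix m m ℝ} (hA : A.PosDef) (hS : S.PosDef) :
    Real.log A.det + Real.log S.det + Fintype.card m ≤ (A * S).trace := by
  obtain ⟨B, hB, rfl⟩ : ∃ B : Matrix m m ℝ, IsUnit B ∧ A = Bᴴ * B :=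
    CStarAlgebra.isStrictlyPositive_iff_eq_star_mul_self.mp hA.isStrictlyPositive
  have hM : (B * S * Bᴴ).PosDef :=
    hS.mul_mul_conjTranspose_same (Matrix.vecMul_injective_of_isUnit hB)
  have htr : (Bᴴ * B * S).trace = (B * S * Bᴴ).trace := by
    rw [Matrix.mul_assoc, Matrix.trace_mul_comm]
  have hdet : (B * S * Bᴴ).det = (Bᴴ * B).det * S.det := by
    simp only [Matrix.det_mul]
    ring
  rw [htr, ← Real.log_mul hA.det_pos.ne' hS.det_pos.ne', ← hdet,
    hM.isHermitian.det_eq_prod_eigenvalues, hM.isHermitian.trace_eq_sum_eigenvalues]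
  simp only [RCLike.ofReal_real_eq_id, id_eq]
  rw [Real.log_prod fun i _ => (hM.eigenvalues_pos i).ne']
  have h := Finset.sum_le_sum fun i (_ : i ∈ Finset.univ) =>
    Real.log_le_sub_one_of_pos (hM.eigenvalues_pos i)
  simp only [Finset.sum_sub_distrib, Finset.sum_const, Finset.card_univ, nsmul_eq_mul,
    mul_one] at h
  linarith

lemma vecMul_blockRow_injective {K N : ℕ} {W : Fin K → Matrix (Fin N) (Fin N) ℝ}
    (hW : ∀ k, IsUnit (W k).det) (n : Fin N) :
    Function.Injective fun v : Fin K → ℝ => v ᵥ* blockRow W n := by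
  intro v w hvw
  ext k
  obtain ⟨j, hj⟩ : ∃ j, W k n j ≠ 0 := by
    by_contra! h
    exact (hW k).ne_zero (Matrix.det_eq_zero_of_row_eq_zero n h)
  have := congrFun hvw (k, j)
  simpa [Matrix.vecMul, dotProduct, blockRow, hj] using this

lemma posDef_blockRow_mul_mul_transpose {K N : ℕ}
    {R : Matrix (Fin K × Fin N) (Fin K × Fin N) ℝ} (hR : R.PosDef)
    {W : Fin K → Matrix (Fin N) (Fin N) ℝ} (hW : ∀ k, IsUnit (W k).det) (n : Fin N) :
    (blockRow W n * R * (blockRow W n)ᵀ).PosDef := by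
  simpa using hR.mul_mul_conjTranspose_same (vecMul_blockRow_injective hW n)

/-- for `R̂` symmetric positive definite and each `W^{[k]}` invertible, the
minimum of `J_IVA-G(W,·)` over tuples of symmetric positive definite matrices equals
`J̃_IVA-G(W) + KN/2`. -/
theorem stmt2 (K N : ℕ) (hK : 0 < K) (hN : 0 < N)
    (R : Matrix (Fin K × Fin N) (Fin K × Fin N) ℝ) (hR : R.PosDef)
    (W : Fin K → Matrix (Fin N) (Fin N) ℝ) (hW : ∀ k, IsUnit (W k).det) :
    IsLeast {x : ℝ | ∃ C : Fin N → Matrix (Fin K) (Fin K) ℝ,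
        (∀ n, (C n).PosDef) ∧ x = JIVAG R W C}
      (JtIVAG R W + (K : ℝ) * N / 2) := by
  have hS := posDef_blockRow_mul_mul_transpose hR hW
  constructor
  · refine ⟨fun n => (blockRow W n * R * (blockRow W n)ᵀ)⁻¹, fun n => (hS n).inv, ?_⟩
    have h (n : Fin N) : ((blockRow W n * R * (blockRow W n)ᵀ)⁻¹ * blockRow W n * R *
          (blockRow W n)ᵀ).trace - Real.log ((blockRow W n * R * (blockRow W n)ᵀ)⁻¹).det =
        K + Real.log (blockRow W n * R * (blockRow W n)ᵀ).det := by
      rw [Matrix.mul_assoc _ (blockRow W n), Matrix.mul_assoc _ (blockRow W n * R),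
        Matrix.nonsing_inv_mul _ (hS n).det_pos.ne'.isUnit, Matrix.det_nonsing_inv,
        Ring.inverse_eq_inv', Real.log_inv]
      simp
    simp only [JIVAG, JtIVAG, h, Finset.sum_add_distrib, Finset.sum_const, Finset.card_univ,
      Fintype.card_fin, nsmul_eq_mul]
    ring
  · rintro _ ⟨C, hC, rfl⟩
    have h := Finset.sum_le_sum fun n (_ : n ∈ Finset.univ) =>
      log_det_add_log_det_add_card_le_trace_mul (hC n) (hS n)
    simp only [← Matrix.mul_assoc, Finset.sum_add_distrib, Finset.sum_const, Finset.card_univ,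
      Fintype.card_fin, nsmul_eq_mul] at h
    simp only [JIVAG, JtIVAG, Finset.sum_sub_distrib] at h ⊢
    linarith
end

section
/- Let K, N be positive integers and let R̂ ∈ ℝ^{KN×KN} be symmetric positive definite. For every pair (W,C) with all W^{[k]} invertible N×N real matrices and all C_n K×K symmetric positive definite matrices, there exists a pair (W′,C′) of the same type such that J_IVA-G(W′,C′) = J_IVA-G(W,C) and every C′_n has all diagonal entries equal to 1. Explicitly, one may take, for each n, D_n = Diag((√(c_{n,1,1}),…,√(c_{n,K,K}))) where c_{n,k,k} are the diagonal entries of C_n, set C′_n = D_n⁻¹ C_n D_n⁻¹, and replace each row w_n^{[k]} of W^{[k]} by √(c_{n,k,k})·w_n^{[k]}. -/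
open Matrix

theorem blockRow_rowScale {K N : ℕ} (s : Fin N → Fin K → ℝ)
    (W : Fin K → Matrix (Fin N) (Fin N) ℝ) (n : Fin N) :
    blockRow (fun k => Matrix.of fun n m => s n k * W k n m) n
      = Matrix.diagonal (s n) * blockRow W n := by
  ext k p
  simp [blockRow, Matrix.diagonal_mul]

theorem det_rowScale {N : ℕ} (s : Fin N → ℝ) (A : Matrix (Fin N) (Fin N) ℝ) :
    (Matrix.of fun n m => s n * A n m).det = (∏ n, s n) * A.det :=
  Matrix.det_mul_column s A

theorem isUnit_det_diagonal {K : ℕ} {s : Fin K → ℝ} (hs : ∀ k, 0 < s k) :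
    IsUnit (Matrix.diagonal s).det := by
  rw [Matrix.det_diagonal, isUnit_iff_ne_zero]
  exact Finset.prod_ne_zero_iff.2 fun k _ => (hs k).ne'

theorem inv_diagonal_of_pos {K : ℕ} {s : Fin K → ℝ} (hs : ∀ k, 0 < s k) :
    (Matrix.diagonal s)⁻¹ = Matrix.diagonal fun k => (s k)⁻¹ := by
  refine Matrix.inv_eq_right_inv ?_
  rw [Matrix.diagonal_mul_diagonal, ← Matrix.diagonal_one]
  congr 1
  ext k
  exact mul_inv_cancel₀ (hs k).ne'

theorem trace_conj_diagonal {K : ℕ} {ι : Type*} [Fintype ι] {s : Fin K → ℝ} (hs : ∀ k, 0 < s k)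
    (C : Matrix (Fin K) (Fin K) ℝ) (B : Matrix (Fin K) ι ℝ) (R : Matrix ι ι ℝ) :
    ((Matrix.diagonal s)⁻¹ * C * (Matrix.diagonal s)⁻¹ * (Matrix.diagonal s * B) * R *
      (Matrix.diagonal s * B)ᵀ).trace = (C * B * R * Bᵀ).trace := by
  have h := isUnit_det_diagonal hs
  rw [Matrix.transpose_mul, Matrix.diagonal_transpose, ← Matrix.mul_assoc _ Bᵀ,
    Matrix.trace_mul_comm]
  simp only [Matrix.mul_assoc]
  rw [Matrix.mul_nonsing_inv_cancel_left _ _ h, Matrix.nonsing_inv_mul_cancel_left _ _ h]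

theorem log_det_conj_diagonal {K : ℕ} {s : Fin K → ℝ} (hs : ∀ k, 0 < s k)
    {C : Matrix (Fin K) (Fin K) ℝ} (hC : C.det ≠ 0) :
    Real.log ((Matrix.diagonal s)⁻¹ * C * (Matrix.diagonal s)⁻¹).det
      = Real.log C.det - 2 * ∑ k, Real.log (s k) := by
  have hp : ∏ k, s k ≠ 0 := Finset.prod_ne_zero_iff.2 fun k _ => (hs k).ne'
  rw [inv_diagonal_of_pos hs, Matrix.det_mul, Matrix.det_mul, Matrix.det_diagonal,
    Finset.prod_inv_distrib, Real.log_mul (mul_ne_zero (inv_ne_zero hp) hC) (inv_ne_zero hp),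
    Real.log_mul (inv_ne_zero hp) hC, Real.log_inv, Real.log_prod fun k _ => (hs k).ne']
  ring

theorem log_abs_det_rowScale {N : ℕ} {s : Fin N → ℝ} (hs : ∀ n, 0 < s n)
    {A : Matrix (Fin N) (Fin N) ℝ} (hA : A.det ≠ 0) :
    Real.log |(Matrix.of fun n m => s n * A n m).det|
      = ∑ n, Real.log (s n) + Real.log |A.det| := by
  rw [det_rowScale, Real.log_abs, Real.log_abs,
    Real.log_mul (Finset.prod_ne_zero_iff.2 fun n _ => (hs n).ne') hA,
    Real.log_prod fun n _ => (hs n).ne']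

/-- The IVA-G cost is invariant under positive rescaling of the rows of the `W^{[k]}` compensated
by the inverse rescaling of the `Cₙ`. -/
theorem JIVAG_rescale {K N : ℕ} (R : Matrix (Fin K × Fin N) (Fin K × Fin N) ℝ)
    {W : Fin K → Matrix (Fin N) (Fin N) ℝ} (hW : ∀ k, (W k).det ≠ 0)
    {C : Fin N → Matrix (Fin K) (Fin K) ℝ} (hC : ∀ n, (C n).det ≠ 0)
    {s : Fin N → Fin K → ℝ} (hs : ∀ n k, 0 < s n k) :
    JIVAG R (fun k => Matrix.of fun n m => s n k * W k n m)
      (fun n => (Matrix.diagonal (s n))⁻¹ * C n * (Matrix.diagonal (s n))⁻¹) = JIVAG R W C := by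
  have hdet : ∀ k, Real.log |(Matrix.of fun n m => s n k * W k n m).det|
      = ∑ n, Real.log (s n k) + Real.log |(W k).det| :=
    fun k => log_abs_det_rowScale (fun n => hs n k) (hW k)
  simp only [JIVAG, blockRow_rowScale, trace_conj_diagonal (hs _),
    log_det_conj_diagonal (hs _) (hC _), hdet, Finset.sum_sub_distrib, Finset.sum_add_distrib,
    ← Finset.mul_sum]
  rw [Finset.sum_comm (f := fun k n => Real.log (s n k))]
  ring

/-- rescaling the rows of the `W^{[k]}` by `√(c_{n,k,k})` and conjugating
each `Cₙ` by `Diag(√(c_{n,k,k}))⁻¹` yields a pair `(W′,C′)` with all `W′^{[k]}`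
invertible, all `C′ₙ` symmetric positive definite with unit diagonal, and the same
IVA-G cost. -/
theorem stmt4 (K N : ℕ) (hK : 0 < K) (hN : 0 < N)
    (R : Matrix (Fin K × Fin N) (Fin K × Fin N) ℝ) (hR : R.PosDef)
    (W : Fin K → Matrix (Fin N) (Fin N) ℝ) (hW : ∀ k, IsUnit (W k).det)
    (C : Fin N → Matrix (Fin K) (Fin K) ℝ) (hC : ∀ n, (C n).PosDef) :
    let W' : Fin K → Matrix (Fin N) (Fin N) ℝ :=
      fun k => Matrix.of fun n m => Real.sqrt (C n k k) * W k n m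
    let C' : Fin N → Matrix (Fin K) (Fin K) ℝ :=
      fun n => (Matrix.diagonal fun k => Real.sqrt (C n k k))⁻¹ * C n *
        (Matrix.diagonal fun k => Real.sqrt (C n k k))⁻¹
    (∀ k, IsUnit (W' k).det) ∧ (∀ n, (C' n).PosDef) ∧
      JIVAG R W' C' = JIVAG R W C ∧ (∀ n k, C' n k k = 1) := by
  have hd : ∀ n k, 0 < C n k k := fun n k => (hC n).diag_pos
  have hs : ∀ n k, 0 < Real.sqrt (C n k k) := fun n k => Real.sqrt_pos.2 (hd n k)
  refine ⟨fun k => ?_, fun n => ?_, ?_, fun n k => ?_⟩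
  · rw [det_rowScale]
    exact (isUnit_iff_ne_zero.2 (Finset.prod_ne_zero_iff.2 fun n _ => (hs n k).ne')).mul (hW k)
  · have hD : IsUnit (Matrix.diagonal fun k => Real.sqrt (C n k k))⁻¹ :=
      (Matrix.isUnit_nonsing_inv_iff).2
        ((Matrix.isUnit_iff_isUnit_det _).2 (isUnit_det_diagonal (hs n)))
    have hDH : ((Matrix.diagonal fun k => Real.sqrt (C n k k))⁻¹)ᴴ
        = (Matrix.diagonal fun k => Real.sqrt (C n k k))⁻¹ := by
      rw [inv_diagonal_of_pos (hs n), Matrix.diagonal_conjTranspose]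
      rfl
    have h := (hC n).conjTranspose_mul_mul_same (Matrix.mulVec_injective_of_isUnit hD)
    rwa [hDH] at h
  · exact JIVAG_rescale R (fun k => (hW k).ne_zero) (fun n => (hC n).det_pos.ne') hs
  · simp only [inv_diagonal_of_pos (hs n), Matrix.mul_diagonal, Matrix.diagonal_mul]
    have := (hs n k).ne'
    field_simp
    exact (Real.sq_sqrt (hd n k).le).symm
end

section
/- Let K, N be positive integers, R̂ ∈ ℝ^{KN×KN} a symmetric matrix, and C = (C_1,…,C_N) an N-tuple of K×K real symmetric matrices. For a collection W = (W^{[k]})_{1≤k≤K} of N×N real matrices, define the tensor G(W) = (G^{[k]}(W))_{1≤k≤K} ∈ ℝ^{N×N×K} with entries G^{[k]}_{n,m}(W) = [C_n W_n R̂]_{k,(k−1)N+m}. Then, with ρ_C = max_{1≤n≤N} ‖C_n‖_S and ϱ_{R̂} = max_{1≤k≤K} ‖R̂^{[k]}‖_S, where R̂^{[k]} is the KN×N matrix formed by columns (k−1)N+1 through kN of R̂, one has ‖G(W)‖_F ≤ ρ_C · ϱ_{R̂} · ‖W‖_F for every W; in particular, since W ↦ G(W) is linear, ‖G(W) − G(W′)‖_F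 ≤ ρ_C · ϱ_{R̂} · ‖W − W′‖_F for all W, W′. -/
open Matrix

/-- Spectral norm of a real matrix: the operator norm of the induced linear map between
Euclidean spaces (equal to its largest singular value). -/
noncomputable def specNorm {m n : Type*} [Fintype m] [Fintype n] [DecidableEq n]
    (A : Matrix m n ℝ) : ℝ :=
  ‖LinearMap.toContinuousLinearMap (Matrix.toEuclideanLin A)‖

/-- Frobenius norm of a third-order tensor. -/
noncomputable def frobT {K N₁ N₂ : ℕ} (T : Fin K → Matrix (Fin N₁) (Fin N₂) ℝ) : ℝ :=
  Real.sqrt (∑ k, ∑ n, ∑ m, (T k n m) ^ 2)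

/-- The tensor `G(W)` with entries `G^{[k]}_{n,m}(W) = [Cₙ Wₙ R̂]_{k,(k−1)N+m}`. -/
def Gmap {K N : ℕ} (R : Matrix (Fin K × Fin N) (Fin K × Fin N) ℝ)
    (C : Fin N → Matrix (Fin K) (Fin K) ℝ)
    (W : Fin K → Matrix (Fin N) (Fin N) ℝ) : Fin K → Matrix (Fin N) (Fin N) ℝ :=
  fun k => Matrix.of fun n m => (C n * blockRow W n * R) k (k, m)

theorem specNorm_nonneg {m n : Type*} [Fintype m] [Fintype n] [DecidableEq n]
    (A : Matrix m n ℝ) : 0 ≤ specNorm A :=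
  norm_nonneg _

theorem specNorm_transpose {m n : Type*} [Fintype m] [Fintype n] [DecidableEq m] [DecidableEq n]
    (A : Matrix m n ℝ) : specNorm Aᵀ = specNorm A := by
  have h := open scoped Matrix.Norms.L2Operator in Matrix.l2_opNorm_conjTranspose A
  rwa [conjTranspose_eq_transpose_of_trivial] at h

theorem sum_sq_mulVec_le {m n : Type*} [Fintype m] [Fintype n] [DecidableEq n]
    (A : Matrix m n ℝ) (v : n → ℝ) :
    ∑ i, (A *ᵥ v) i ^ 2 ≤ specNorm A ^ 2 * ∑ j, v j ^ 2 := by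
  have h := (LinearMap.toContinuousLinearMap (Matrix.toEuclideanLin A)).le_opNorm
    (WithLp.toLp 2 v)
  have h2 := pow_le_pow_left₀ (norm_nonneg _) h 2
  rw [mul_pow, EuclideanSpace.real_norm_sq_eq, EuclideanSpace.real_norm_sq_eq] at h2
  exact h2

theorem sum_sq_vecMul_le {m n : Type*} [Fintype m] [Fintype n] [DecidableEq m] [DecidableEq n]
    (A : Matrix m n ℝ) (v : m → ℝ) :
    ∑ j, (v ᵥ* A) j ^ 2 ≤ specNorm A ^ 2 * ∑ i, v i ^ 2 := by
  simpa only [mulVec_transpose, specNorm_transpose] using sum_sq_mulVec_le Aᵀ v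

/-- The Frobenius norm of a product is at most the spectral norm of the left factor times the
Frobenius norm of the right factor. -/
theorem sum_sq_mul_le {l m n : Type*} [Fintype l] [Fintype m] [Fintype n] [DecidableEq m]
    (A : Matrix l m ℝ) (B : Matrix m n ℝ) :
    ∑ i, ∑ j, (A * B) i j ^ 2 ≤ specNorm A ^ 2 * ∑ i, ∑ j, B i j ^ 2 := by
  rw [Finset.sum_comm, Finset.sum_comm (γ := m), Finset.mul_sum]
  exact Finset.sum_le_sum fun j _ => sum_sq_mulVec_le A fun i => B i j

theorem sum_sq_blockRow {K N : ℕ} (W : Fin K → Matrix (Fin N) (Fin N) ℝ) (n : Fin N)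
    (k : Fin K) : ∑ p, blockRow W n k p ^ 2 = ∑ m, W k n m ^ 2 := by
  simp [blockRow, Fintype.sum_prod_type_right, ite_pow]

theorem blockRow_sub {K N : ℕ} (W W' : Fin K → Matrix (Fin N) (Fin N) ℝ) (n : Fin N) :
    blockRow (W - W') n = blockRow W n - blockRow W' n := by
  ext k p
  by_cases h : p.1 = k <;> simp [blockRow, h]

theorem Gmap_sub {K N : ℕ} (R : Matrix (Fin K × Fin N) (Fin K × Fin N) ℝ)
    (C : Fin N → Matrix (Fin K) (Fin K) ℝ) (W W' : Fin K → Matrix (Fin N) (Fin N) ℝ) :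
    Gmap R C (W - W') = Gmap R C W - Gmap R C W' := by
  ext k n m
  simp [Gmap, blockRow_sub, Matrix.mul_sub, Matrix.sub_mul]

theorem frobT_Gmap_le {K N : ℕ} (R : Matrix (Fin K × Fin N) (Fin K × Fin N) ℝ)
    (C : Fin N → Matrix (Fin K) (Fin K) ℝ) {c r : ℝ} (hc : 0 ≤ c) (hr : 0 ≤ r)
    (hC : ∀ n, specNorm (C n) ≤ c)
    (hR : ∀ k, specNorm (Matrix.of fun (p : Fin K × Fin N) (m : Fin N) => R p (k, m)) ≤ r)
    (W : Fin K → Matrix (Fin N) (Fin N) ℝ) : frobT (Gmap R C W) ≤ c * r * frobT W := by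
  have hrow (k : Fin K) (n : Fin N) :
      ∑ m, Gmap R C W k n m ^ 2 ≤ r ^ 2 * ∑ p, (C n * blockRow W n) k p ^ 2 :=
    (sum_sq_vecMul_le (Matrix.of fun (p : Fin K × Fin N) (m : Fin N) => R p (k, m))
      ((C n * blockRow W n) k)).trans <| by
        gcongr
        exacts [specNorm_nonneg _, hR k]
  have hslice (n : Fin N) :
      ∑ k, ∑ p, (C n * blockRow W n) k p ^ 2 ≤ c ^ 2 * ∑ k, ∑ m, W k n m ^ 2 := by
    refine (sum_sq_mul_le (C n) (blockRow W n)).trans ?_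
    simp only [sum_sq_blockRow]
    gcongr
    exacts [specNorm_nonneg _, hC n]
  refine Real.sqrt_le_iff.2 ⟨by unfold frobT; positivity, ?_⟩
  rw [mul_pow, frobT, Real.sq_sqrt (by positivity)]
  calc ∑ k, ∑ n, ∑ m, Gmap R C W k n m ^ 2
      ≤ ∑ k, ∑ n, r ^ 2 * ∑ p, (C n * blockRow W n) k p ^ 2 :=
        Finset.sum_le_sum fun k _ => Finset.sum_le_sum fun n _ => hrow k n
    _ = r ^ 2 * ∑ n, ∑ k, ∑ p, (C n * blockRow W n) k p ^ 2 := by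
        rw [Finset.sum_comm]
        simp only [Finset.mul_sum]
    _ ≤ r ^ 2 * ∑ n, c ^ 2 * ∑ k, ∑ m, W k n m ^ 2 := by
        gcongr with n
        exact hslice n
    _ = (c * r) ^ 2 * ∑ k, ∑ n, ∑ m, W k n m ^ 2 := by
        rw [← Finset.mul_sum, Finset.sum_comm]
        ring

/-- with `ρ_C = maxₙ ‖Cₙ‖_S` and `ϱ_R̂ = maxₖ ‖R̂^{[k]}‖_S` (where `R̂^{[k]}`
is the k-th block of N columns of `R̂`), one has `‖G(W)‖_F ≤ ρ_C·ϱ_R̂·‖W‖_F` for all `W`;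
in particular, since `G` is linear, `‖G(W) − G(W′)‖_F ≤ ρ_C·ϱ_R̂·‖W − W′‖_F`. -/
theorem stmt6 (K N : ℕ) (hK : 0 < K) (hN : 0 < N)
    (R : Matrix (Fin K × Fin N) (Fin K × Fin N) ℝ) (hR : Rᵀ = R)
    (C : Fin N → Matrix (Fin K) (Fin K) ℝ) (hC : ∀ n, (C n)ᵀ = C n) :
    let ρC : ℝ := ⨆ n : Fin N, specNorm (C n)
    let ϱR : ℝ := ⨆ k : Fin K, specNorm (Matrix.of fun (p : Fin K × Fin N) (m : Fin N) => R p (k, m))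
    (∀ W : Fin K → Matrix (Fin N) (Fin N) ℝ, frobT (Gmap R C W) ≤ ρC * ϱR * frobT W) ∧
    (∀ W W' : Fin K → Matrix (Fin N) (Fin N) ℝ,
      frobT (Gmap R C W - Gmap R C W') ≤ ρC * ϱR * frobT (W - W')) := by
  intro ρC ϱR
  have key (W : Fin K → Matrix (Fin N) (Fin N) ℝ) :
      frobT (Gmap R C W) ≤ ρC * ϱR * frobT W :=
    frobT_Gmap_le R C (Real.iSup_nonneg fun _ => specNorm_nonneg _)
      (Real.iSup_nonneg fun _ => specNorm_nonneg _)
      (le_ciSup (Set.finite_range _).bddAbove) (le_ciSup (f := fun k : Fin K =>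
        specNorm (Matrix.of fun (p : Fin K × Fin N) (m : Fin N) => R p (k, m)))
        (Set.finite_range _).bddAbove) W
  exact ⟨key, fun W W' => Gmap_sub R C W W' ▸ key (W - W')⟩
end

section
/- Let K be a positive integer, c > 0, ε > 0, and let C′ ∈ ℝ^{K×K} be symmetric with eigendecomposition C′ = U·Diag(λ)·Uᵀ, where U ∈ ℝ^{K×K} is orthogonal and λ ∈ ℝ^K. Then the function C ↦ (1/2)·‖C − C′‖²_F − (c/2)·log det C, defined on the set of symmetric matrices C with C − εI_K positive semidefinite (and +∞ elsewhere), attains its global minimum over ℝ^{K×K} at the point U·Diag(τ)·Uᵀ, where τ_ℓ = max(ε, (λ_ℓ + √(λ_ℓ² + 2c))/2) for every ℓ ∈ {1,…,K}. -/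
open Matrix

namespace Matrix

variable {n : Type*} [Fintype n]

theorem PosDef.log_det_le_trace_sub_card_s11 [DecidableEq n] {M : Matrix n n ℝ} (hM : M.PosDef) :
    Real.log M.det ≤ M.trace - Fintype.card n := by
  have hdet := hM.isHermitian.det_eq_prod_eigenvalues
  have htr := hM.isHermitian.trace_eq_sum_eigenvalues
  simp only [RCLike.ofReal_real_eq_id, id_eq] at hdet htr
  rw [hdet, htr, Real.log_prod (fun i _ => (hM.eigenvalues_pos i).ne')]
  calc ∑ i, Real.log (hM.isHermitian.eigenvalues i)
      ≤ ∑ i, (hM.isHermitian.eigenvalues i - 1) :=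
        Finset.sum_le_sum fun i _ => Real.log_le_sub_one_of_pos (hM.eigenvalues_pos i)
    _ = _ := by simp [Finset.sum_sub_distrib]

/-- The tangent-plane inequality for the concave function `log det` at a diagonal matrix. -/
theorem PosDef.log_det_le_sum_log_add [DecidableEq n] {D : Matrix n n ℝ} (hD : D.PosDef)
    {t : n → ℝ} (ht : ∀ i, 0 < t i) :
    Real.log D.det ≤ ∑ i, (Real.log (t i) + D i i / t i - 1) := by
  set S : Matrix n n ℝ := diagonal fun i => (√(t i))⁻¹ with hS
  have hpos : ∀ i, 0 < √(t i) := fun i => Real.sqrt_pos.2 (ht i)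
  have hSu : IsUnit S := by
    rw [isUnit_iff_isUnit_det, hS, det_diagonal, isUnit_iff_ne_zero]
    exact Finset.prod_ne_zero_iff.2 fun i _ => (inv_pos.2 (hpos i)).ne'
  have hM : (Sᴴ * D * S).PosDef :=
    hD.conjTranspose_mul_mul_same (mulVec_injective_iff_isUnit.2 hSu)
  have hST : Sᴴ = S := by simp [hS]
  rw [hST] at hM
  have key := hM.log_det_le_trace_sub_card_s11
  have htr : (S * D * S).trace = ∑ i, D i i / t i := by
    simp only [trace, diag_apply, hS, mul_diagonal, diagonal_mul]
    refine Finset.sum_congr rfl fun i _ => ?_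
    rw [div_eq_mul_inv]
    nth_rewrite 3 [← Real.mul_self_sqrt (ht i).le]
    rw [mul_inv]
    ring
  have hSdet : S.det * S.det = (∏ i, t i)⁻¹ := by
    rw [hS, det_diagonal, ← Finset.prod_mul_distrib, ← Finset.prod_inv_distrib]
    refine Finset.prod_congr rfl fun i _ => ?_
    rw [← mul_inv, Real.mul_self_sqrt (ht i).le]
  have hdet : (S * D * S).det = (∏ i, t i)⁻¹ * D.det := by
    rw [det_mul, det_mul, ← hSdet]
    ring
  have hprod : (∏ i, t i) ≠ 0 := Finset.prod_ne_zero_iff.2 fun i _ => (ht i).ne'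
  rw [hdet, htr, Real.log_mul (inv_ne_zero hprod) hD.det_pos.ne', Real.log_inv,
    Real.log_prod fun i _ => (ht i).ne'] at key
  simp only [Finset.sum_sub_distrib, Finset.sum_add_distrib, Finset.sum_const, Finset.card_univ,
    nsmul_eq_mul, mul_one]
  linarith

theorem sum_sq_eq_trace_transpose_mul (A : Matrix n n ℝ) :
    ∑ i, ∑ j, A i j ^ 2 = (Aᵀ * A).trace := by
  rw [Finset.sum_comm]
  simp [trace, mul_apply, sq]

theorem sum_sq_orthogonal_conj [DecidableEq n] {U : Matrix n n ℝ} (hU : Uᵀ * U = 1)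
    (B : Matrix n n ℝ) :
    ∑ i, ∑ j, (U * B * Uᵀ) i j ^ 2 = ∑ i, ∑ j, B i j ^ 2 := by
  rw [sum_sq_eq_trace_transpose_mul, sum_sq_eq_trace_transpose_mul]
  have h : (U * B * Uᵀ)ᵀ * (U * B * Uᵀ) = U * (Bᵀ * B * Uᵀ) := by
    simp only [transpose_mul, transpose_transpose, Matrix.mul_assoc]
    rw [← Matrix.mul_assoc Uᵀ U, hU, Matrix.one_mul]
  rw [h, trace_mul_comm, Matrix.mul_assoc, hU, Matrix.mul_one]

theorem sum_diag_sq_le_sum_sq (A : Matrix n n ℝ) :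
    ∑ i, A i i ^ 2 ≤ ∑ i, ∑ j, A i j ^ 2 :=
  Finset.sum_le_sum fun i _ =>
    Finset.single_le_sum (f := fun j => A i j ^ 2) (fun _ _ => sq_nonneg _) (Finset.mem_univ i)

theorem det_orthogonal_conj [DecidableEq n] {U : Matrix n n ℝ} (hU : Uᵀ * U = 1)
    (B : Matrix n n ℝ) : (U * B * Uᵀ).det = B.det := by
  rw [det_mul, det_mul, mul_right_comm, ← det_mul, mul_eq_one_comm.1 hU, det_one, one_mul]

end Matrix

/-- The linearization at `t = max ε r`, with `r` the positive root of `t² - l t - c/2`, of the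
logarithmic term in `(d - l)² / 2 - (c / 2) log d` is minimized over `d ≥ ε` at `d = t`. -/
theorem half_sq_sub_le_of_eq_max {c ε l d t : ℝ} (hc : 0 < c) (hε : 0 < ε) (hd : ε ≤ d)
    (ht : t = max ε ((l + Real.sqrt (l ^ 2 + 2 * c)) / 2)) :
    1 / 2 * (t - l) ^ 2 ≤ 1 / 2 * (d - l) ^ 2 - c / 2 * (d / t - 1) := by
  set s := Real.sqrt (l ^ 2 + 2 * c) with hs
  have hs2 : s ^ 2 = l ^ 2 + 2 * c := Real.sq_sqrt (by positivity)
  have hs0 : 0 ≤ s := Real.sqrt_nonneg _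
  have htpos : 0 < t := ht ▸ lt_max_of_lt_left hε
  have key : 0 ≤ (d - t) * (2 * t ^ 2 - 2 * l * t - c) := by
    rcases le_total ε ((l + s) / 2) with h | h
    · rw [max_eq_right h] at ht
      have : 2 * t ^ 2 - 2 * l * t - c = 0 := by rw [ht]; linear_combination hs2 / 2
      rw [this, mul_zero]
    · rw [max_eq_left h] at ht
      subst ht
      refine mul_nonneg (sub_nonneg.2 hd) ?_
      have h1 : 0 ≤ 2 * t - l - s := by linarith
      nlinarith [mul_nonneg h1 (by linarith : 0 ≤ 2 * t - l + s)]
  have h : 1 / 2 * (d - l) ^ 2 - c / 2 * (d / t - 1) - 1 / 2 * (t - l) ^ 2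
      = 1 / 2 * (d - t) ^ 2 + (d - t) * (2 * t ^ 2 - 2 * l * t - c) / (2 * t) := by
    field_simp
    ring
  have : 0 ≤ 1 / 2 * (d - t) ^ 2 + (d - t) * (2 * t ^ 2 - 2 * l * t - c) / (2 * t) := by
    positivity
  linarith

/-- given an eigendecomposition `C′ = U·Diag(λ)·Uᵀ` of a symmetric matrix
with `U` orthogonal, the function `C ↦ (1/2)·‖C − C′‖²_F − (c/2)·log det C`, defined on
symmetric matrices `C` with `C − εI` positive semidefinite (and `+∞` elsewhere), attains
its global minimum at `U·Diag(τ)·Uᵀ` with `τ_ℓ = max(ε, (λ_ℓ + √(λ_ℓ² + 2c))/2)`. -/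
theorem stmt11 (K : ℕ) (hK : 0 < K) (c ε : ℝ) (hc : 0 < c) (hε : 0 < ε)
    (U : Matrix (Fin K) (Fin K) ℝ) (hU : Uᵀ * U = 1) (lam : Fin K → ℝ)
    (C' : Matrix (Fin K) (Fin K) ℝ) (hC'sym : C'ᵀ = C')
    (hC' : C' = U * Matrix.diagonal lam * Uᵀ) :
    let τ : Fin K → ℝ := fun l => max ε ((lam l + Real.sqrt ((lam l) ^ 2 + 2 * c)) / 2)
    let Cs : Matrix (Fin K) (Fin K) ℝ := U * Matrix.diagonal τ * Uᵀ
    let F : Matrix (Fin K) (Fin K) ℝ → ℝ := fun C =>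
      (1/2) * (∑ i, ∑ j, (C i j - C' i j) ^ 2) - (c/2) * Real.log C.det
    (Cs - ε • (1 : Matrix (Fin K) (Fin K) ℝ)).PosSemidef ∧
    (∀ C : Matrix (Fin K) (Fin K) ℝ,
      (C - ε • (1 : Matrix (Fin K) (Fin K) ℝ)).PosSemidef → F Cs ≤ F C) := by
  intro τ Cs F
  have hτε : ∀ l, ε ≤ τ l := fun l => le_max_left _ _
  have hτ : ∀ l, 0 < τ l := fun l => hε.trans_le (hτε l)
  have hU' : U * Uᵀ = 1 := mul_eq_one_comm.1 hU
  have hconj : ∀ A : Matrix (Fin K) (Fin K) ℝ, U * (Uᵀ * A * U) * Uᵀ = A := fun A => by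
    calc U * (Uᵀ * A * U) * Uᵀ = (U * Uᵀ) * A * (U * Uᵀ) := by simp only [Matrix.mul_assoc]
      _ = A := by rw [hU', Matrix.one_mul, Matrix.mul_one]
  have hF : ∀ B : Matrix (Fin K) (Fin K) ℝ, F (U * B * Uᵀ) =
      (1/2) * (∑ i, ∑ j, (B - Matrix.diagonal lam) i j ^ 2) - (c/2) * Real.log B.det := by
    intro B
    rw [← Matrix.sum_sq_orthogonal_conj hU, ← Matrix.det_orthogonal_conj hU B, Matrix.mul_sub,
      Matrix.sub_mul, ← hC']
    simp only [F, Matrix.sub_apply]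
  refine ⟨?_, fun C hC => ?_⟩
  · have h : Cs - ε • (1 : Matrix (Fin K) (Fin K) ℝ) =
        U * Matrix.diagonal (fun l => τ l - ε) * Uᴴ := by
      rw [← Matrix.diagonal_sub, Matrix.mul_sub, Matrix.sub_mul,
        Matrix.conjTranspose_eq_transpose_of_trivial, ← Matrix.smul_one_eq_diagonal, Matrix.mul_smul, Matrix.mul_one, Matrix.smul_mul, hU']
    rw [h]
    exact (Matrix.PosSemidef.diagonal fun l => sub_nonneg.2 (hτε l)).mul_mul_conjTranspose_same U
  · set D := Uᵀ * C * U with hD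
    have hDε : (D - ε • (1 : Matrix (Fin K) (Fin K) ℝ)).PosSemidef := by
      have h := hC.conjTranspose_mul_mul_same U
      rwa [Matrix.conjTranspose_eq_transpose_of_trivial, Matrix.mul_sub, Matrix.sub_mul,
        Matrix.mul_smul, Matrix.mul_one, Matrix.smul_mul, hU] at h
    have hDpos : D.PosDef := by
      have h := (Matrix.PosDef.one.smul hε).add_posSemidef hDε
      rwa [add_sub_cancel] at h
    have hdiag : ∀ l, ε ≤ D l l := fun l => by
      have h := hDε.diag_nonneg (i := l)
      simpa using h
    have hCD : C = U * D * Uᵀ := (hconj C).symm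
    rw [hCD, hF D, hF (Matrix.diagonal τ)]
    have hlog := hDpos.log_det_le_sum_log_add hτ
    have hsq := Matrix.sum_diag_sq_le_sum_sq (D - Matrix.diagonal lam)
    have hdiagsq : ∑ i, ∑ j, (Matrix.diagonal τ - Matrix.diagonal lam) i j ^ 2 =
        ∑ i, (τ i - lam i) ^ 2 := by
      rw [Matrix.diagonal_sub]
      simp [Matrix.diagonal_apply, ite_pow]
    rw [hdiagsq, Matrix.det_diagonal, Real.log_prod fun l _ => (hτ l).ne']
    simp only [Matrix.sub_apply, Matrix.diagonal_apply_eq] at hsq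
    have hsum := Finset.sum_le_sum fun l (_ : l ∈ Finset.univ) =>
      half_sq_sub_le_of_eq_max (t := τ l) hc hε (hdiag l) rfl
    simp only [add_sub_assoc, Finset.sum_add_distrib] at hlog
    rw [Finset.sum_sub_distrib, ← Finset.mul_sum, ← Finset.mul_sum, ← Finset.mul_sum] at hsum
    simp only [Matrix.sub_apply]
    have hlog' := mul_le_mul_of_nonneg_left hlog (half_pos hc).le
    linarith
end

section
/- Let K be a positive integer and φ : ℝ^K → (−∞,+∞] a function that is invariant under all permutations of its arguments. Let M′ ∈ ℝ^{K×K} be symmetric with eigendecomposition M′ = U·Diag(λ)·Uᵀ, where U is orthogonal and λ ∈ ℝ^K is sorted in nonincreasing order. Define Φ on symmetric K×K matrices by Φ(M) = φ(eigenvalues of M, in any order). If μ ∈ ℝ^K is sorted in nonincreasing order and minimizes ν ↦ (1/2)·‖ν − λ‖² + φ(ν) over ℝ^K, then U·Diag(μ)·Uᵀ minimizes M ↦ (1/2)·‖M − M′‖²_F + Φ(M) over the set of K×K real symmetric matrices. -/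
open Matrix Classical

/-- The spectral function `Φ(M) = φ(eigenvalues of M)` associated with a
permutation-invariant function `φ : ℝ^K → (−∞,+∞]`, extended by `+∞` to non-symmetric
matrices. -/
noncomputable def PhiSpec {K : ℕ} (φ : (Fin K → ℝ) → EReal)
    (M : Matrix (Fin K) (Fin K) ℝ) : EReal :=
  if hM : M.IsHermitian then φ hM.eigenvalues else ⊤

/-- Left multiplication by an orthogonal matrix preserves the sum of squared entries. -/
theorem sum_sq_orthogonal_mul {n : Type*} [Fintype n] [DecidableEq n] {Q : Matrix n n ℝ}
    (hQ : Qᵀ * Q = 1) (A : Matrix n n ℝ) :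
    ∑ i, ∑ j, (Q * A) i j ^ 2 = ∑ i, ∑ j, A i j ^ 2 := by
  have key (B : Matrix n n ℝ) : ∑ i, ∑ j, B i j ^ 2 = (Bᵀ * B).trace := by
    rw [Finset.sum_comm]
    simp [Matrix.trace, Matrix.mul_apply, sq]
  rw [key, key, transpose_mul, Matrix.mul_assoc, ← Matrix.mul_assoc Qᵀ, hQ, Matrix.one_mul]

/-- Right multiplication by an orthogonal matrix preserves the sum of squared entries. -/
theorem sum_sq_mul_orthogonal {n : Type*} [Fintype n] [DecidableEq n] {Q : Matrix n n ℝ}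
    (hQ : Qᵀ * Q = 1) (A : Matrix n n ℝ) :
    ∑ i, ∑ j, (A * Q) i j ^ 2 = ∑ i, ∑ j, A i j ^ 2 := by
  have key (B : Matrix n n ℝ) : ∑ i, ∑ j, B i j ^ 2 = ∑ i, ∑ j, Bᵀ i j ^ 2 :=
    Finset.sum_comm
  have hQ' : Qᵀᵀ * Qᵀ = 1 := by rw [transpose_transpose]; exact mul_eq_one_comm.mp hQ
  rw [key (A * Q), transpose_mul, sum_sq_orthogonal_mul hQ', ← key]

/-- The squared Frobenius distance of two orthogonally diagonalized matrices, in terms of the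
overlaps of the eigenvectors. -/
theorem sum_sq_sub_diagonalized {n : Type*} [Fintype n] [DecidableEq n] {U V : Matrix n n ℝ}
    (hU : Uᵀ * U = 1) (hV : Vᵀ * V = 1) (a b : n → ℝ) :
    ∑ i, ∑ j, ((V * diagonal a * Vᵀ) i j - (U * diagonal b * Uᵀ) i j) ^ 2 =
      ∑ i, ∑ j, (Uᵀ * V) i j ^ 2 * (a j - b i) ^ 2 := by
  have hU' : Uᵀᵀ * Uᵀ = 1 := by rw [transpose_transpose]; exact mul_eq_one_comm.mp hU
  have h : Uᵀ * (V * diagonal a * Vᵀ - U * diagonal b * Uᵀ) * V =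
      Uᵀ * V * diagonal a - diagonal b * (Uᵀ * V) := by
    calc _ = Uᵀ * V * diagonal a * (Vᵀ * V) - (Uᵀ * U) * diagonal b * (Uᵀ * V) := by
          noncomm_ring
      _ = _ := by rw [hU, hV, Matrix.mul_one, Matrix.one_mul]
  simp_rw [← Matrix.sub_apply]
  rw [← sum_sq_orthogonal_mul hU', ← sum_sq_mul_orthogonal hV, h]
  refine Finset.sum_congr rfl fun i _ => Finset.sum_congr rfl fun j _ => ?_
  rw [Matrix.sub_apply, mul_diagonal, diagonal_mul]
  ring

/-- The entrywise square of an orthogonal matrix is doubly stochastic. -/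
theorem sq_entries_mem_doublyStochastic {n : Type*} [Fintype n] [DecidableEq n]
    {Q : Matrix n n ℝ} (hQ : Qᵀ * Q = 1) :
    Matrix.of (fun i j => Q i j ^ 2) ∈ doublyStochastic ℝ n := by
  have hQ' : Q * Qᵀ = 1 := mul_eq_one_comm.mp hQ
  refine mem_doublyStochastic_iff_sum.mpr ⟨fun i j => sq_nonneg _, fun i => ?_, fun j => ?_⟩
  · simpa [Matrix.mul_apply, sq] using congrFun (congrFun hQ' i) i
  · simpa [Matrix.mul_apply, sq] using congrFun (congrFun hQ j) j

/-- A **Hoffman–Wielandt inequality**: the Frobenius distance of two orthogonally diagonalized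
matrices is at least the distance of their spectra under a suitable matching. -/
theorem exists_perm_sum_sq_le {n : Type*} [Fintype n] [DecidableEq n] {U V : Matrix n n ℝ}
    (hU : Uᵀ * U = 1) (hV : Vᵀ * V = 1) (a b : n → ℝ) :
    ∃ π : Equiv.Perm n, ∑ i, (a (π i) - b i) ^ 2 ≤
      ∑ i, ∑ j, ((V * diagonal a * Vᵀ) i j - (U * diagonal b * Uᵀ) i j) ^ 2 := by
  have hUV : (Uᵀ * V)ᵀ * (Uᵀ * V) = 1 := by
    rw [transpose_mul, transpose_transpose, Matrix.mul_assoc, ← Matrix.mul_assoc U,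
      mul_eq_one_comm.mp hU, Matrix.one_mul, hV]
  have hmem : Matrix.of (fun i j => (Uᵀ * V) i j ^ 2) ∈
      convexHull ℝ {σ.permMatrix ℝ | σ : Equiv.Perm n} := by
    rw [← doublyStochastic_eq_convexHull_permMatrix]
    exact sq_entries_mem_doublyStochastic hUV
  have hconc : ConcaveOn ℝ Set.univ
      (fun P : Matrix n n ℝ => ∑ i, ∑ j, P i j * (a j - b i) ^ 2) := by
    refine ⟨convex_univ, fun P _ R _ s t _ _ _ => le_of_eq ?_⟩
    simp only [smul_eq_mul, Finset.mul_sum, ← Finset.sum_add_distrib, Matrix.add_apply,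
      Matrix.smul_apply]
    refine Finset.sum_congr rfl fun i _ => Finset.sum_congr rfl fun j _ => ?_
    ring
  obtain ⟨_, ⟨π, rfl⟩, hle⟩ := hconc.exists_le_of_mem_convexHull (Set.subset_univ _) hmem
  refine ⟨π, ?_⟩
  rw [sum_sq_sub_diagonalized hU hV]
  simpa [Equiv.toPEquiv_apply, PEquiv.toMatrix_apply] using hle

/-- A real symmetric matrix is diagonalized by an orthogonal matrix of eigenvectors. -/
theorem Matrix.IsHermitian.exists_orthogonal_diagonalization {n : Type*} [Fintype n]
    [DecidableEq n] {M : Matrix n n ℝ} (hM : M.IsHermitian) :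
    ∃ V : Matrix n n ℝ, Vᵀ * V = 1 ∧ M = V * diagonal hM.eigenvalues * Vᵀ := by
  refine ⟨hM.eigenvectorUnitary, ?_, ?_⟩
  · simpa [star_eq_conjTranspose] using Unitary.coe_star_mul_self hM.eigenvectorUnitary
  · have h := hM.spectral_theorem
    rw [Unitary.conjStarAlgAut_apply] at h
    simpa [star_eq_conjTranspose, Function.comp_def] using h

/-- let `φ : ℝ^K → (−∞,+∞]` be permutation invariant and let
`M′ = U·Diag(λ)·Uᵀ` be a symmetric matrix with `U` orthogonal and `λ` nonincreasing.
If `μ`, sorted nonincreasingly, minimizes `ν ↦ (1/2)‖ν − λ‖² + φ(ν)` over `ℝ^K`, then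
`U·Diag(μ)·Uᵀ` minimizes `M ↦ (1/2)‖M − M′‖²_F + Φ(M)` over symmetric matrices, where
`Φ(M) = φ(eigenvalues of M)`. -/
theorem stmt12 (K : ℕ) (hK : 0 < K) (φ : (Fin K → ℝ) → EReal)
    (hperm : ∀ (ν : Fin K → ℝ) (π : Equiv.Perm (Fin K)), φ (ν ∘ π) = φ ν)
    (M' U : Matrix (Fin K) (Fin K) ℝ) (hM' : M'.IsHermitian)
    (hU : Uᵀ * U = 1) (lam : Fin K → ℝ) (hlam : Antitone lam)
    (hdecomp : M' = U * Matrix.diagonal lam * Uᵀ)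
    (μ : Fin K → ℝ) (hμ : Antitone μ)
    (hmin : ∀ ν : Fin K → ℝ,
      (((1/2) * ∑ l, (μ l - lam l) ^ 2 : ℝ) : EReal) + φ μ ≤
        (((1/2) * ∑ l, (ν l - lam l) ^ 2 : ℝ) : EReal) + φ ν) :
    ∀ M : Matrix (Fin K) (Fin K) ℝ, M.IsHermitian →
      (((1/2) * ∑ i, ∑ j, ((U * Matrix.diagonal μ * Uᵀ) i j - M' i j) ^ 2 : ℝ) : EReal)
          + PhiSpec φ (U * Matrix.diagonal μ * Uᵀ) ≤
        (((1/2) * ∑ i, ∑ j, (M i j - M' i j) ^ 2 : ℝ) : EReal) + PhiSpec φ M := by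
  have hdist : ∑ i, ∑ j, ((U * diagonal μ * Uᵀ) i j - M' i j) ^ 2 =
      ∑ l, (μ l - lam l) ^ 2 := by
    rw [hdecomp, sum_sq_sub_diagonalized hU hU, hU]
    simp [Matrix.one_apply]
  have hN : (U * diagonal μ * Uᵀ).IsHermitian := by
    simpa using isHermitian_mul_mul_conjTranspose U (isHermitian_diagonal μ)
  have hPhi : PhiSpec φ (U * diagonal μ * Uᵀ) = φ μ := by
    obtain ⟨V, hV, hNV⟩ := hN.exists_orthogonal_diagonalization
    obtain ⟨π, hπ⟩ := exists_perm_sum_sq_le hU hV hN.eigenvalues μ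
    rw [← hNV] at hπ
    have hzero : ∑ i, (hN.eigenvalues (π i) - μ i) ^ 2 = 0 :=
      le_antisymm (by simpa using hπ) (Finset.sum_nonneg fun i _ => sq_nonneg _)
    have hμπ : hN.eigenvalues ∘ π = μ := by
      funext i
      rw [Finset.sum_eq_zero_iff_of_nonneg fun i _ => sq_nonneg _] at hzero
      exact sub_eq_zero.mp (pow_eq_zero_iff two_ne_zero |>.mp (hzero i (Finset.mem_univ i)))
    rw [PhiSpec, dif_pos hN, ← hperm hN.eigenvalues π, hμπ]
  intro M hM
  obtain ⟨V, hV, hMV⟩ := hM.exists_orthogonal_diagonalization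
  obtain ⟨π, hπ⟩ := exists_perm_sum_sq_le hU hV hM.eigenvalues lam
  rw [← hMV, ← hdecomp] at hπ
  rw [hdist, hPhi, PhiSpec, dif_pos hM, ← hperm hM.eigenvalues π]
  refine (hmin (hM.eigenvalues ∘ π)).trans (add_le_add ?_ le_rfl)
  exact EReal.coe_le_coe_iff.mpr (mul_le_mul_of_nonneg_left hπ (by norm_num))
end

section
/- Let K, M be positive integers, σ > 0, W ∈ ℝ^{K×M}, and let R ∈ ℝ^{M×M} be symmetric with R − σ·I_M positive semidefinite. Then det(W R Wᵀ) ≥ σ^K · det(W Wᵀ). -/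
open Matrix

theorem Matrix.PosSemidef.one_le_det_one_add {n : Type*} [Fintype n] [DecidableEq n]
    {P : Matrix n n ℝ} (hP : P.PosSemidef) : 1 ≤ (1 + P).det := by
  have h : (1 + P).det = ∏ i, (1 + hP.1.eigenvalues i) := by
    conv_lhs => rw [hP.1.spectral_theorem, Unitary.conjStarAlgAut_apply]
    rw [det_one_add_mul_comm, ← Matrix.mul_assoc, Unitary.coe_star_mul_self, Matrix.one_mul,
      ← diagonal_one, diagonal_add, det_diagonal]
    simp
  rw [h]
  exact Finset.one_le_prod fun i _ => le_add_of_nonneg_right (hP.eigenvalues_nonneg i)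

open scoped MatrixOrder in
theorem Matrix.PosSemidef.det_le_det_add {n : Type*} [Fintype n] [DecidableEq n]
    {A B : Matrix n n ℝ} (hA : A.PosSemidef) (hB : B.PosSemidef) : A.det ≤ (A + B).det := by
  by_cases hdet : A.det = 0
  · rw [hdet]
    exact (hA.add hB).det_nonneg
  obtain ⟨C, rfl⟩ : ∃ C : Matrix n n ℝ, A = Cᴴ * C :=
    CStarAlgebra.nonneg_iff_eq_star_mul_self.mp (nonneg_iff_posSemidef.mpr hA)
  have hC : IsUnit C.det := by
    rw [isUnit_iff_ne_zero]
    rintro h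
    exact hdet (by rw [det_mul, h, mul_zero])
  have hCinv : C⁻¹ * C = 1 := nonsing_inv_mul C hC
  have hCinv' : Cᴴ * C⁻¹ᴴ = 1 := by rw [← conjTranspose_mul, hCinv, conjTranspose_one]
  have hfactor : Cᴴ * C + B = Cᴴ * (1 + C⁻¹ᴴ * B * C⁻¹) * C := by
    rw [Matrix.mul_add, Matrix.add_mul, Matrix.mul_one]
    congr 1
    calc B = (Cᴴ * C⁻¹ᴴ) * B * (C⁻¹ * C) := by
          rw [hCinv, hCinv', Matrix.one_mul, Matrix.mul_one]
      _ = _ := by simp only [Matrix.mul_assoc]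
  have h := (hB.conjTranspose_mul_mul_same C⁻¹).one_le_det_one_add
  have hdet_nonneg := hA.det_nonneg
  rw [hfactor, det_mul (_ * _) C, det_mul Cᴴ (1 + _), mul_right_comm, ← det_mul]
  exact le_mul_of_one_le_right hdet_nonneg h

/-- for `σ > 0`, `W ∈ ℝ^{K×M}` and `R ∈ ℝ^{M×M}` symmetric with `R − σI`
positive semidefinite, one has `det(W R Wᵀ) ≥ σ^K · det(W Wᵀ)`. -/
theorem stmt13 (K M : ℕ) (hK : 0 < K) (hM : 0 < M) (σ : ℝ) (hσ : 0 < σ)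
    (W : Matrix (Fin K) (Fin M) ℝ) (R : Matrix (Fin M) (Fin M) ℝ)
    (hRsym : Rᵀ = R) (hR : (R - σ • (1 : Matrix (Fin M) (Fin M) ℝ)).PosSemidef) :
    σ ^ K * (W * Wᵀ).det ≤ (W * R * Wᵀ).det := by
  have hA : (σ • (W * Wᵀ)).PosSemidef := by
    simpa using (posSemidef_self_mul_conjTranspose W).smul hσ.le
  have hB : (W * (R - σ • (1 : Matrix (Fin M) (Fin M) ℝ)) * Wᵀ).PosSemidef := by
    simpa using hR.mul_mul_conjTranspose_same W
  have hsum : W * R * Wᵀ =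
      σ • (W * Wᵀ) + W * (R - σ • (1 : Matrix (Fin M) (Fin M) ℝ)) * Wᵀ := by
    simp [Matrix.mul_sub, Matrix.sub_mul]
  simpa [hsum, det_smul] using hA.det_le_det_add hB
end

section
/- Let N be a positive integer and a > 0. For every invertible matrix W ∈ ℝ^{N×N}, log|det W| ≤ (a/4)·‖W‖²_F + (N/2)·(log(2/a) − 1); equivalently, −log|det W| ≥ −(a/4)·‖W‖²_F − (N/2)·(log(2/a) − 1). -/
open Matrix

theorem log_le_log_add_mul_sub_one {a x : ℝ} (ha : 0 < a) (hx : 0 < x) :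
    Real.log x ≤ Real.log (2 / a) + a / 2 * x - 1 := by
  have h := Real.log_le_sub_one_of_pos (show 0 < a / 2 * x by positivity)
  rw [Real.log_mul (by positivity) hx.ne', ← inv_div 2 a, Real.log_inv, inv_div] at h
  linarith

/-- for `a > 0` and every invertible `W ∈ ℝ^{N×N}`,
`log|det W| ≤ (a/4)·‖W‖²_F + (N/2)·(log(2/a) − 1)`; equivalently
`−log|det W| ≥ −(a/4)·‖W‖²_F − (N/2)·(log(2/a) − 1)`. -/
theorem stmt18 (N : ℕ) (hN : 0 < N) (a : ℝ) (ha : 0 < a)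
    (W : Matrix (Fin N) (Fin N) ℝ) (hW : IsUnit W.det) :
    Real.log |W.det| ≤ (a/4) * (∑ i, ∑ j, (W i j) ^ 2)
      + ((N : ℝ)/2) * (Real.log (2/a) - 1) := by
  have hp : (W * Wᴴ).PosSemidef := posSemidef_self_mul_conjTranspose W
  have hH : (W * Wᴴ).IsHermitian := hp.isHermitian
  have hdet : W.det ^ 2 = ∏ i, hH.eigenvalues i := by
    have h := hH.det_eq_prod_eigenvalues
    simpa [det_mul, sq] using h
  have htr : ∑ i, ∑ j, W i j ^ 2 = ∑ i, hH.eigenvalues i := by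
    have h := hH.trace_eq_sum_eigenvalues
    simpa [trace, mul_apply, sq] using h
  have hne : ∀ i, hH.eigenvalues i ≠ 0 := by
    have h : ∏ i, hH.eigenvalues i ≠ 0 := hdet ▸ pow_ne_zero 2 hW.ne_zero
    simpa [Finset.prod_ne_zero_iff] using h
  have hlog : 2 * Real.log |W.det| = ∑ i, Real.log (hH.eigenvalues i) := by
    rw [← Real.log_prod fun i _ => hne i, ← hdet, Real.log_pow, Real.log_abs]
    norm_num
  have hle : ∑ i, Real.log (hH.eigenvalues i) ≤
      ∑ i, (Real.log (2 / a) + a / 2 * hH.eigenvalues i - 1) :=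
    Finset.sum_le_sum fun i _ =>
      log_le_log_add_mul_sub_one ha ((hp.eigenvalues_nonneg i).lt_of_ne' (hne i))
  rw [Finset.sum_sub_distrib, Finset.sum_add_distrib, ← Finset.mul_sum, ← htr] at hle
  simp only [Finset.sum_const, Finset.card_univ, Fintype.card_fin, nsmul_eq_mul, mul_one] at hle
  linarith
end
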